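/- Let Ξ denote the double-star: the tree with six vertices {a, b, x₁, x₂, y₁, y₂} and edges {a,b}, {a,x₁}, {a,x₂}, {b,y₁}, {b,y₂}. Then for every finite forest F (finite acyclic simple graph), there exists an injective group homomorphism from C(F) to C(Ξ). -/

import Mathlib

/-- The defining relations of the right-angled Coxeter group of a simple graph:
squares of the generators, and squares of products of generators corresponding to
adjacent vertices. -/
def racgRels {V : Type*} (G : SimpleGraph V) : Set (FreeGroup V) :=
  {r | (∃ v : V, r = FreeGroup.of v * FreeGroup.of v) ∨
    ∃ u v : V, G.Adj u v ∧ r = (FreeGroup.of u * FreeGroup.of v) ^ 2}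

/-- The right-angled Coxeter group of a simple graph. -/
abbrev RACG {V : Type*} (G : SimpleGraph V) : Type _ := PresentedGroup (racgRels G)

/-- The canonical generator of the right-angled Coxeter group corresponding to a vertex. -/
def racgGen {V : Type*} (G : SimpleGraph V) (v : V) : RACG G := PresentedGroup.of v

/-- A reflection of a right-angled Coxeter group: a conjugate of a canonical generator. -/
def IsReflection {V : Type*} (G : SimpleGraph V) (x : RACG G) : Prop :=
  ∃ (g : RACG G) (v : V), x = g * racgGen G v * g⁻¹

/-- Word length on a right-angled Coxeter group with respect to the canonical generators
(the generators are involutions, so words in the generators suffice). -/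
noncomputable def racgLen {V : Type*} (G : SimpleGraph V) (x : RACG G) : ℕ :=
  sInf {n | ∃ l : List V, l.length = n ∧ (l.map (racgGen G)).prod = x}
/-- The double-star: the tree with two adjacent vertices `0` and `1` of degree three,
vertices `2, 3` attached to `0` and vertices `4, 5` attached to `1`. -/
def doubleStar : SimpleGraph (Fin 6) :=
  SimpleGraph.fromRel (fun x y =>
    (x = 0 ∧ y = 1) ∨ (x = 0 ∧ y = 2) ∨ (x = 0 ∧ y = 3) ∨ (x = 1 ∧ y = 4) ∨ (x = 1 ∧ y = 5))


namespace SimpleGraph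

/-- A nonempty finite forest has a vertex with at most one neighbour. -/
theorem IsAcyclic.exists_neighborSet_subsingleton {V : Type*} [Finite V] [Nonempty V]
    {G : SimpleGraph V} (h : G.IsAcyclic) : ∃ v, (G.neighborSet v).Subsingleton := by
  obtain ⟨u, v, p, hp, hmax⟩ := Walk.exists_isPath_forall_isPath_length_le_length G
  refine ⟨u, fun x hx y hy => ?_⟩
  have key : ∀ w, G.Adj u w → w = p.snd := by
    intro w hadj
    apply h.eq_snd_of_adj_start hp hadj
    have : ¬(p.cons hadj.symm).IsPath := by grind [Walk.length_cons]
    grind [hp.cons]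
  rw [key x hx, key y hy]

/-- In a graph with infinite degrees and without 4-cycles, every vertex `u` has a neighbour which
avoids a given finite set and is adjacent to no other member of that set. -/
theorem exists_adj_forall_not_adj {T : Type*} {G : SimpleGraph T}
    (hinf : ∀ p, (G.neighborSet p).Infinite)
    (hsq : ∀ p p', p ≠ p' → (G.neighborSet p ∩ G.neighborSet p').Subsingleton)
    {s : Set T} (hs : s.Finite) (u : T) :
    ∃ q, G.Adj u q ∧ q ∉ s ∧ ∀ p ∈ s, p ≠ u → ¬ G.Adj p q := by
  have hbad : (s ∪ ⋃ p ∈ s \ {u}, (G.neighborSet u ∩ G.neighborSet p)).Finite :=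
    hs.union (hs.sdiff.biUnion fun p hp => (hsq u p (Ne.symm hp.2)).finite)
  obtain ⟨q, hq, hqb⟩ := (hinf u).exists_notMem_finite hbad
  simp only [Set.mem_union, Set.mem_iUnion, not_or, not_exists] at hqb
  exact ⟨q, hq, hqb.1, fun p hp hpu hadj => hqb.2 p ⟨hp, hpu⟩ ⟨hq, hadj⟩⟩

/-- Every finite forest is an induced subgraph of any nonempty graph with infinite degrees and
without 4-cycles. -/
theorem IsAcyclic.nonempty_embedding {T : Type*} [Nonempty T] {G : SimpleGraph T}
    (hinf : ∀ p, (G.neighborSet p).Infinite)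
    (hsq : ∀ p p', p ≠ p' → (G.neighborSet p ∩ G.neighborSet p').Subsingleton)
    {V : Type*} [Finite V] {F : SimpleGraph V} (hF : F.IsAcyclic) : Nonempty (F ↪g G) := by
  classical
  obtain ⟨n, hn⟩ : ∃ n, Nat.card V = n := ⟨_, rfl⟩
  induction n generalizing V with
  | zero =>
    have : IsEmpty V := (Finite.card_eq_zero_iff).1 hn
    exact ⟨⟨⟨isEmptyElim, fun a => isEmptyElim a⟩, fun {a} => isEmptyElim a⟩⟩
  | succ n ih =>
    have : Nonempty V := (Nat.card_pos_iff.1 (by lia)).1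
    obtain ⟨v, hv⟩ := hF.exists_neighborSet_subsingleton
    obtain ⟨e⟩ := ih (hF.induce {v}ᶜ) (by
      have := Set.ncard_add_ncard_compl ({v} : Set V)
      rw [Set.ncard_singleton, hn] at this
      rw [Nat.card_coe_set_eq]
      lia)
    have hfin : (Set.range e).Finite := Set.finite_range e
    obtain ⟨q, hqs, hq⟩ : ∃ q, q ∉ Set.range e ∧ ∀ u, G.Adj (e u) q ↔ F.Adj u v := by
      by_cases h : ∃ u, F.Adj v u
      · obtain ⟨u, hu⟩ := h
        obtain ⟨q, huq, hqs, hq⟩ := exists_adj_forall_not_adj hinf hsq hfin (e ⟨u, hu.ne'⟩)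
        refine ⟨q, hqs, fun w => ⟨fun hw => ?_, fun hw => ?_⟩⟩
        · by_contra hwv
          refine hq _ ⟨w, rfl⟩ (fun heq => hwv ?_) hw
          rw [e.injective heq]
          exact hu.symm
        · have : w = ⟨u, hu.ne'⟩ := Subtype.ext (hv hw.symm hu)
          rwa [this]
      · push Not at h
        obtain ⟨p, -, hps, -⟩ := exists_adj_forall_not_adj hinf hsq hfin (Classical.arbitrary T)
        obtain ⟨q, hpq, hqs, hq⟩ := exists_adj_forall_not_adj hinf hsq hfin p
        refine ⟨q, hqs, fun w => ⟨fun hw => ?_, fun hw => absurd hw.symm (h w)⟩⟩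
        exact absurd hw (hq _ ⟨w, rfl⟩ fun heq => hps ⟨w, heq⟩)
    have hqe : ∀ u, e u ≠ q := fun u hu => hqs ⟨u, hu⟩
    refine ⟨⟨⟨fun u => if h : u = v then q else e ⟨u, Set.mem_compl_singleton_iff.2 h⟩,
      fun a b hab => ?_⟩, fun {a b} => ?_⟩⟩
    · dsimp only at hab
      split_ifs at hab with ha hb hb
      · rw [ha, hb]
      · exact absurd hab.symm (hqe _)
      · exact absurd hab (hqe _)
      · exact congrArg Subtype.val (e.injective hab)
    · change G.Adj (dite _ _ _) (dite _ _ _) ↔ _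
      split_ifs with ha hb hb
      · simp [ha, hb]
      · rw [G.adj_comm, hq, ha, F.adj_comm]
      · rw [hq, hb]
      · exact e.map_rel_iff

end SimpleGraph

section Lift

variable {V : Type*} {G : SimpleGraph V} {H : Type*} [Group H]

theorem racgGen_mul_self (G : SimpleGraph V) (v : V) : racgGen G v * racgGen G v = 1 :=
  PresentedGroup.one_of_mem (rels := racgRels G) (Or.inl ⟨v, rfl⟩)

theorem commute_racgGen {u v : V} (h : G.Adj u v) : Commute (racgGen G u) (racgGen G v) := by
  have h1 : (racgGen G u * racgGen G v) ^ 2 = 1 :=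
    PresentedGroup.one_of_mem (rels := racgRels G) (Or.inr ⟨u, v, h, rfl⟩)
  have hu := inv_eq_of_mul_eq_one_left (racgGen_mul_self G u)
  have hv := inv_eq_of_mul_eq_one_left (racgGen_mul_self G v)
  rw [pow_two, mul_eq_one_iff_eq_inv, mul_inv_rev, hu, hv] at h1
  exact h1

/-- The universal property of a right-angled Coxeter group. -/
def racgLift (f : V → H) (hsq : ∀ v, f v * f v = 1)
    (hcomm : ∀ u v, G.Adj u v → Commute (f u) (f v)) : RACG G →* H :=
  PresentedGroup.toGroup (f := f) (by
    rintro r (⟨v, rfl⟩ | ⟨u, v, h, rfl⟩)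
    · simp [hsq]
    · simp only [map_pow, map_mul, FreeGroup.lift_apply_of]
      rw [(hcomm u v h).mul_pow, pow_two, pow_two, hsq, hsq, one_mul])

@[simp]
theorem racgLift_racgGen (f : V → H) (hsq : ∀ v, f v * f v = 1)
    (hcomm : ∀ u v, G.Adj u v → Commute (f u) (f v)) (v : V) :
    racgLift f hsq hcomm (racgGen G v) = f v :=
  PresentedGroup.toGroup.of _

theorem racg_hom_ext {f g : RACG G →* H} (h : ∀ v, f (racgGen G v) = g (racgGen G v)) : f = g :=
  PresentedGroup.ext h

variable {V₂ : Type*} {G₂ : SimpleGraph V₂}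

/-- The homomorphism of right-angled Coxeter groups induced by a graph homomorphism. -/
def racgMap (f : G →g G₂) : RACG G →* RACG G₂ :=
  racgLift (fun v => racgGen G₂ (f v)) (fun _ => racgGen_mul_self _ _)
    fun _ _ h => commute_racgGen (f.map_adj h)

@[simp]
theorem racgMap_racgGen (f : G →g G₂) (v : V) : racgMap f (racgGen G v) = racgGen G₂ (f v) :=
  racgLift_racgGen _ _ _ v

theorem racgMap_injective (e : G ↪g G₂) : Function.Injective (racgMap e.toHom) := by
  classical
  let r : RACG G₂ →* RACG G := racgLift
    (fun t => if h : ∃ v, e v = t then racgGen G h.choose else 1)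
    (fun t => by split_ifs <;> simp [racgGen_mul_self])
    (fun s t hst => by
      split_ifs with h h'
      · refine commute_racgGen (e.map_rel_iff.1 ?_)
        rwa [h.choose_spec, h'.choose_spec]
      all_goals simp)
  have hr : r.comp (racgMap e.toHom) = MonoidHom.id _ := racg_hom_ext fun v => by
    have h : ∃ w, e w = e v := ⟨v, rfl⟩
    simp [r]
  exact Function.LeftInverse.injective (g := r) fun x => DFunLike.congr_fun hr x

/-- A group acting on a graph acts on the right-angled Coxeter group of the graph. -/
def racgAut {W : Type*} [Group W] [MulAction W V]
    (hadj : ∀ (w : W) (u v : V), G.Adj u v → G.Adj (w • u) (w • v)) : W →* MulAut (RACG G) :=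
  let m : W → RACG G →* RACG G := fun w => racgMap ⟨fun v => w • v, fun h => hadj w _ _ h⟩
  { toFun := fun w => MonoidHom.toMulEquiv (m w) (m w⁻¹)
      (racg_hom_ext fun v => by simp [m]) (racg_hom_ext fun v => by simp [m])
    map_one' := MulEquiv.toMonoidHom_injective (racg_hom_ext fun v => by simp [m])
    map_mul' := fun w w' =>
      MulEquiv.toMonoidHom_injective (racg_hom_ext fun v => by simp [m, mul_smul]) }

theorem racgAut_racgGen {W : Type*} [Group W] [MulAction W V]
    (hadj : ∀ (w : W) (u v : V), G.Adj u v → G.Adj (w • u) (w • v)) (w : W) (v : V) :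
    racgAut hadj w (racgGen G v) = racgGen G (w • v) := by
  simp [racgAut]

end Lift

section BassSerreTree

open Monoid (CoprodI)

namespace Monoid.CoprodI

variable {ι : Type*} {M : ι → Type*} [∀ i, Monoid (M i)]

theorem NeWord.prod_ne_one {i j : ι} (w : NeWord M i j) : w.prod ≠ 1 := by
  classical
  intro h
  have h' : w.toWord = Word.empty := Word.equiv.symm.injective (by
    change w.prod = Word.empty.prod
    rw [h, Word.prod_empty])
  exact w.toList_ne_nil (congrArg Word.toList h')

theorem of_mul_of_ne_one {i j : ι} (hij : i ≠ j) {x : M i} {y : M j} (hx : x ≠ 1) (hy : y ≠ 1) :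
    (of x * of y : CoprodI M) ≠ 1 := by
  have := (NeWord.append (.singleton x hx) hij (.singleton y hy)).prod_ne_one
  simpa using this

theorem of_mul_of_mul_of_mul_of_ne_one {i j : ι} (hij : i ≠ j) {x z : M i} {y t : M j}
    (hx : x ≠ 1) (hy : y ≠ 1) (hz : z ≠ 1) (ht : t ≠ 1) :
    (of x * of y * (of z * of t) : CoprodI M) ≠ 1 := by
  have := (NeWord.append (.append (.singleton x hx) hij (.singleton y hy)) hij.symm
    (.append (.singleton z hz) hij (.singleton t ht))).prod_ne_one
  simpa using this

/-- A closed path of length four in the Bass-Serre tree of a free product backtracks. -/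
theorem eq_one_or_eq_one_of_prod_eq_one {G : ι → Type*} [∀ i, Group (G i)] {i j : ι} (hij : i ≠ j)
    {x z : G i} {y t : G j} (h : (of x * of y * (of z * of t) : CoprodI G) = 1) :
    x = 1 ∨ y = 1 := by
  by_contra! hxy
  obtain ⟨hx, hy⟩ := hxy
  by_cases ht : t = 1
  · subst ht
    have h1 : (of (z * x) * of y : CoprodI G) = 1 := by
      have h2 := congrArg (fun w => of z * w * (of z)⁻¹) h
      simpa [mul_assoc] using h2
    by_cases hzx : z * x = 1
    · rw [hzx, map_one, one_mul] at h1
      exact hy (of_injective j (h1.trans (map_one _).symm))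
    · exact of_mul_of_ne_one hij hzx hy h1
  · by_cases hz : z = 1
    · subst hz
      have h1 : (of x * of (y * t) : CoprodI G) = 1 := by simpa [mul_assoc] using h
      by_cases hyt : y * t = 1
      · rw [hyt, map_one, mul_one] at h1
        exact hx (of_injective i (h1.trans (map_one _).symm))
      · exact of_mul_of_ne_one hij hx hyt h1
    · exact of_mul_of_mul_of_mul_of_ne_one hij hx hy hz ht h

end Monoid.CoprodI

variable (D : Type*) [Group D]

/-- The free product of two copies of a group. -/
abbrev FreeSquare : Type _ := CoprodI fun _ : Bool => D

/-- The vertices of the Bass-Serre tree of the free product of two copies of a group: the cosets of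
the two factors. -/
abbrev FactorCoset : Type _ :=
  Σ c : Bool, FreeSquare D ⧸ (CoprodI.of (M := fun _ : Bool => D) (i := c)).range

variable {D}

/-- The coset of the factor indexed by `c` represented by `w`. -/
def factorCoset (c : Bool) (w : FreeSquare D) : FactorCoset D := ⟨c, w⟩

theorem factorCoset_eq_iff {c : Bool} {w w' : FreeSquare D} :
    factorCoset c w = factorCoset c w' ↔ ∃ d : D, w' = w * CoprodI.of (i := c) d := by
  rw [factorCoset, factorCoset, Sigma.mk.injEq, heq_eq_eq, QuotientGroup.eq, and_iff_right rfl]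
  constructor
  · rintro ⟨d, hd⟩
    exact ⟨d, by rw [hd, mul_inv_cancel_left]⟩
  · rintro ⟨d, rfl⟩
    exact ⟨d, by rw [inv_mul_cancel_left]⟩

theorem exists_eq_factorCoset (p : FactorCoset D) : ∃ c w, p = factorCoset c w := by
  obtain ⟨c, q⟩ := p
  obtain ⟨w, rfl⟩ := QuotientGroup.mk_surjective q
  exact ⟨c, w, rfl⟩

variable (D) in
/-- The Bass-Serre tree of the free product of two copies of a group: cosets of different factors
are adjacent when they intersect. -/
def bassSerreTree : SimpleGraph (FactorCoset D) where
  Adj p q := ∃ c w, p = factorCoset c w ∧ q = factorCoset (!c) w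
  symm := ⟨by
    rintro p q ⟨c, w, rfl, rfl⟩
    exact ⟨!c, w, rfl, by rw [Bool.not_not]⟩⟩
  loopless := ⟨by
    rintro p ⟨c, w, rfl, h⟩
    have h' : c = !c := congrArg Sigma.fst h
    cases c <;> simp at h'⟩

theorem bassSerreTree_adj_iff {c : Bool} {w : FreeSquare D} {q : FactorCoset D} :
    (bassSerreTree D).Adj (factorCoset c w) q ↔
      ∃ d : D, q = factorCoset (!c) (w * CoprodI.of (i := c) d) := by
  constructor
  · rintro ⟨c', w', h, rfl⟩
    obtain rfl : c = c' := congrArg Sigma.fst h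
    obtain ⟨d, rfl⟩ := factorCoset_eq_iff.1 h
    exact ⟨d, rfl⟩
  · rintro ⟨d, rfl⟩
    exact ⟨c, _, factorCoset_eq_iff.2 ⟨d, rfl⟩, rfl⟩

theorem bassSerreTree_adj_smul (g : FreeSquare D) (p q : FactorCoset D)
    (h : (bassSerreTree D).Adj p q) : (bassSerreTree D).Adj (g • p) (g • q) := by
  obtain ⟨c, w, rfl, rfl⟩ := h
  exact ⟨c, g * w, rfl, rfl⟩

theorem factorCoset_mul_right_injective (c : Bool) (w : FreeSquare D) :
    Function.Injective fun d : D => factorCoset (!c) (w * CoprodI.of (i := c) d) := by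
  intro d d' h
  obtain ⟨e, he⟩ := factorCoset_eq_iff.1 h
  by_contra hne
  have h1 : (CoprodI.of (i := c) d' : FreeSquare D) =
      CoprodI.of (i := c) d * CoprodI.of (i := !c) e := by
    rw [mul_assoc] at he
    exact mul_left_cancel he
  have h2 : (CoprodI.of (i := c) (d'⁻¹ * d) * CoprodI.of (i := !c) e : FreeSquare D) = 1 := by
    rw [map_mul, map_inv, mul_assoc, ← h1, inv_mul_cancel]
  have hd : d'⁻¹ * d ≠ 1 := fun h => hne (inv_mul_eq_one.1 h).symm
  by_cases he1 : e = 1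
  · rw [he1, map_one, mul_one] at h1
    exact hne (CoprodI.of_injective c h1).symm
  · exact CoprodI.of_mul_of_ne_one (by cases c <;> simp) hd he1 h2

theorem bassSerreTree_neighborSet_infinite [Infinite D] (p : FactorCoset D) :
    ((bassSerreTree D).neighborSet p).Infinite := by
  obtain ⟨c, w, rfl⟩ := exists_eq_factorCoset p
  refine (Set.infinite_range_of_injective (factorCoset_mul_right_injective c w)).mono ?_
  rintro _ ⟨d, rfl⟩
  exact bassSerreTree_adj_iff.2 ⟨d, rfl⟩

theorem bassSerreTree_inter_neighborSet_subsingleton (p p' : FactorCoset D) (hne : p ≠ p') :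
    ((bassSerreTree D).neighborSet p ∩ (bassSerreTree D).neighborSet p').Subsingleton := by
  rintro q ⟨hq, hq'⟩ r ⟨hr, hr'⟩
  obtain ⟨c, w, rfl, rfl⟩ := hq
  obtain ⟨d, rfl⟩ := bassSerreTree_adj_iff.1 hr
  obtain ⟨e, rfl⟩ := bassSerreTree_adj_iff.1 hq'.symm
  obtain ⟨f, hf⟩ := bassSerreTree_adj_iff.1 hr'.symm
  have hc : (!c) ≠ c := by cases c <;> simp
  rw [Bool.not_not] at hne hf
  obtain ⟨g, hg⟩ := factorCoset_eq_iff.1 hf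
  rw [mul_assoc, mul_assoc] at hg
  have h1 := mul_left_cancel hg
  have h2 : (CoprodI.of (i := !c) e⁻¹ * CoprodI.of (i := c) d *
      (CoprodI.of (i := !c) f * CoprodI.of (i := c) g⁻¹) : FreeSquare D) = 1 := by
    rw [map_inv, map_inv, mul_assoc, ← mul_assoc _ _ (_)⁻¹, h1, mul_inv_cancel_right,
      inv_mul_cancel]
  rcases CoprodI.eq_one_or_eq_one_of_prod_eq_one hc h2 with h | h
  · rw [inv_eq_one.1 h, map_one, mul_one] at hne
    exact absurd rfl hne
  · rw [h, map_one, mul_one]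

end BassSerreTree

theorem infinite_racg_bot : Infinite (RACG (⊥ : SimpleGraph Bool)) := by
  let f : RACG (⊥ : SimpleGraph Bool) →* DihedralGroup 0 :=
    racgLift (fun b => DihedralGroup.sr (if b then 1 else 0))
      (fun _ => by simp) (fun _ _ h => h.elim)
  have hf : ∀ n : ℕ, f ((racgGen ⊥ false * racgGen ⊥ true) ^ n) = DihedralGroup.r (n : ZMod 0) :=
    fun n => by simp [f]
  refine Infinite.of_injective (fun n : ℕ => (racgGen ⊥ false * racgGen ⊥ true) ^ n) fun m n h => ?_
  have h' := congrArg f h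
  simp only [hf, DihedralGroup.r.injEq] at h'
  exact Int.ofNat_injective h'

theorem forall_doubleStar_adj {P : Fin 6 → Fin 6 → Prop} (hP : ∀ i j, P i j → P j i)
    (h01 : P 0 1) (h02 : P 0 2) (h03 : P 0 3) (h14 : P 1 4) (h15 : P 1 5) (i j : Fin 6)
    (h : doubleStar.Adj i j) : P i j := by
  rw [doubleStar, SimpleGraph.fromRel_adj] at h
  rcases h.2 with h | h
  · rcases h with ⟨rfl, rfl⟩ | ⟨rfl, rfl⟩ | ⟨rfl, rfl⟩ | ⟨rfl, rfl⟩ | ⟨rfl, rfl⟩ <;> assumption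
  · rcases h with ⟨rfl, rfl⟩ | ⟨rfl, rfl⟩ | ⟨rfl, rfl⟩ | ⟨rfl, rfl⟩ | ⟨rfl, rfl⟩ <;>
      exact hP _ _ ‹_›

/-- The central vertices of the double-star. -/
def doubleStarCenter (c : Bool) : Fin 6 := if c then 1 else 0

/-- The two leaves of the double-star attached to a central vertex. -/
def doubleStarLeaf (c i : Bool) : Fin 6 :=
  if c then (if i then 5 else 4) else (if i then 3 else 2)

theorem doubleStar_adj_center (c : Bool) :
    doubleStar.Adj (doubleStarCenter c) (doubleStarCenter !c) := by
  cases c <;> simp [doubleStar, doubleStarCenter]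

theorem doubleStar_adj_leaf (c i : Bool) :
    doubleStar.Adj (doubleStarCenter c) (doubleStarLeaf c i) := by
  cases c <;> cases i <;> simp [doubleStar, doubleStarCenter, doubleStarLeaf]

/-- The infinite dihedral group, as the right-angled Coxeter group of two isolated vertices. -/
abbrev InfDihedral : Type := RACG (⊥ : SimpleGraph Bool)

/-- The homomorphism onto the subgroup generated by the leaves of the double-star. -/
def leafHom : FreeSquare InfDihedral →* RACG doubleStar :=
  Monoid.CoprodI.lift fun c => racgLift (fun i => racgGen doubleStar (doubleStarLeaf c i))
    (fun _ => racgGen_mul_self _ _) (fun _ _ h => h.elim)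

@[simp]
theorem leafHom_of_racgGen (c i : Bool) :
    leafHom (Monoid.CoprodI.of (i := c) (racgGen ⊥ i)) =
      racgGen doubleStar (doubleStarLeaf c i) := by
  simp [leafHom]

theorem commute_leafHom_of (c : Bool) (d : InfDihedral) :
    Commute (leafHom (Monoid.CoprodI.of (i := c) d))
      (racgGen doubleStar (doubleStarCenter c)) := by
  let f : InfDihedral →* RACG doubleStar :=
    leafHom.comp (Monoid.CoprodI.of (M := fun _ : Bool => InfDihedral) (i := c))
  have hf : (MulAut.conj (racgGen doubleStar (doubleStarCenter c))).toMonoidHom.comp f = f :=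
    racg_hom_ext fun i => by
      simpa [f] using (commute_racgGen (doubleStar_adj_leaf c i)).mul_inv_cancel
  have h := DFunLike.congr_fun hf d
  exact (mul_inv_eq_iff_eq_mul.1 h).symm

/-- The reflection of the double-star group attached to a vertex of the Bass-Serre tree. -/
noncomputable def treeReflection (p : FactorCoset InfDihedral) : RACG doubleStar :=
  leafHom p.2.out * racgGen doubleStar (doubleStarCenter p.1) * (leafHom p.2.out)⁻¹

theorem treeReflection_factorCoset (c : Bool) (w : FreeSquare InfDihedral) :
    treeReflection (factorCoset c w) =
      leafHom w * racgGen doubleStar (doubleStarCenter c) * (leafHom w)⁻¹ := by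
  obtain ⟨d, hd⟩ : ∃ d, (factorCoset c w).2.out = w * Monoid.CoprodI.of (i := c) d :=
    (factorCoset_eq_iff (w' := (factorCoset c w).2.out)).1
      (congrArg (Sigma.mk c) (QuotientGroup.out_eq' _).symm)
  rw [treeReflection, hd, map_mul, mul_inv_rev, mul_assoc (leafHom w)]
  change leafHom w * (_ * racgGen doubleStar (doubleStarCenter c)) * _ = _
  rw [(commute_leafHom_of c d).eq]
  group

/-- The homomorphism sending the vertices of the Bass-Serre tree to the corresponding reflections
of the double-star group. -/
noncomputable def treeHom : RACG (bassSerreTree InfDihedral) →* RACG doubleStar :=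
  racgLift treeReflection
    (fun p => by
      obtain ⟨c, w, rfl⟩ := exists_eq_factorCoset p
      rw [treeReflection_factorCoset, conj_mul, racgGen_mul_self, mul_one, mul_inv_cancel])
    (by
      rintro _ _ ⟨c, w, rfl, rfl⟩
      rw [treeReflection_factorCoset, treeReflection_factorCoset, Commute.conj_iff]
      exact commute_racgGen (doubleStar_adj_center c))

/-- The semidirect product of the right-angled Coxeter group of the Bass-Serre tree with the free
product acting on the tree. -/
abbrev TreeSemidirect : Type :=
  RACG (bassSerreTree InfDihedral) ⋊[racgAut bassSerreTree_adj_smul] FreeSquare InfDihedral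

open SemidirectProduct in
/-- The images of the generators of the double-star group in the semidirect product. -/
def semidirectGen : Fin 6 → TreeSemidirect :=
  let z (c : Bool) : TreeSemidirect := inl (racgGen _ (factorCoset c 1))
  let l (c i : Bool) : TreeSemidirect := inr (Monoid.CoprodI.of (i := c) (racgGen ⊥ i))
  ![z false, z true, l false false, l false true, l true false, l true true]

theorem semidirectGen_center (c : Bool) : semidirectGen (doubleStarCenter c) =
    SemidirectProduct.inl (racgGen _ (factorCoset c 1)) := by
  cases c <;> rfl

theorem semidirectGen_leaf (c i : Bool) : semidirectGen (doubleStarLeaf c i) =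
    SemidirectProduct.inr (Monoid.CoprodI.of (i := c) (racgGen ⊥ i)) := by
  cases c <;> cases i <;> rfl

theorem semidirectGen_mul_self (j : Fin 6) : semidirectGen j * semidirectGen j = 1 := by
  have hz (c) : semidirectGen (doubleStarCenter c) * semidirectGen (doubleStarCenter c) = 1 := by
    rw [semidirectGen_center, ← map_mul, racgGen_mul_self, map_one]
  have hl (c i) : semidirectGen (doubleStarLeaf c i) * semidirectGen (doubleStarLeaf c i) = 1 := by
    rw [semidirectGen_leaf, ← map_mul, ← map_mul, racgGen_mul_self, map_one, map_one]
  fin_cases j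
  exacts [hz false, hz true, hl false false, hl false true, hl true false, hl true true]

theorem commute_semidirectGen (j k : Fin 6) (h : doubleStar.Adj j k) :
    Commute (semidirectGen j) (semidirectGen k) := by
  have hl (c i) : Commute (semidirectGen (doubleStarCenter c))
      (semidirectGen (doubleStarLeaf c i)) := by
    rw [semidirectGen_center, semidirectGen_leaf]
    refine (mul_inv_eq_iff_eq_mul.1 ?_).symm
    rw [← map_inv, ← SemidirectProduct.inl_aut, racgAut_racgGen]
    congr 2
    exact (factorCoset_eq_iff.2 ⟨racgGen ⊥ i, by rw [one_mul]; exact (mul_one _).symm⟩).symm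
  refine forall_doubleStar_adj (P := fun j k => Commute (semidirectGen j) (semidirectGen k))
    (fun _ _ h => h.symm) ?_ (hl false false) (hl false true) (hl true false) (hl true true) j k h
  have hadj : (bassSerreTree InfDihedral).Adj (factorCoset false 1) (factorCoset true 1) :=
    ⟨false, 1, rfl, rfl⟩
  exact (commute_racgGen hadj).map SemidirectProduct.inl

/-- The homomorphism from the double-star group to the semidirect product. -/
def toTreeSemidirect : RACG doubleStar →* TreeSemidirect :=
  racgLift semidirectGen semidirectGen_mul_self commute_semidirectGen

theorem toTreeSemidirect_leafHom (w : FreeSquare InfDihedral) :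
    toTreeSemidirect (leafHom w) = SemidirectProduct.inr w := by
  have h : toTreeSemidirect.comp leafHom = SemidirectProduct.inr :=
    Monoid.CoprodI.ext_hom _ _ fun c => racg_hom_ext fun i => by
      simp [toTreeSemidirect, semidirectGen_leaf]
  exact DFunLike.congr_fun h w

theorem treeHom_injective : Function.Injective treeHom := by
  have h : toTreeSemidirect.comp treeHom = SemidirectProduct.inl := racg_hom_ext fun p => by
    obtain ⟨c, w, rfl⟩ := exists_eq_factorCoset p
    have hz : toTreeSemidirect (racgGen doubleStar (doubleStarCenter c)) =
        SemidirectProduct.inl (racgGen _ (factorCoset c 1)) :=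
      (racgLift_racgGen _ _ _ _).trans (semidirectGen_center c)
    rw [MonoidHom.comp_apply, treeHom, racgLift_racgGen, treeReflection_factorCoset, map_mul,
      map_mul, map_inv, toTreeSemidirect_leafHom, hz, ← map_inv, ← SemidirectProduct.inl_aut,
      racgAut_racgGen]
    congr 2
    exact congrArg (factorCoset c) (mul_one w)
  refine Function.Injective.of_comp (f := toTreeSemidirect) ?_
  rw [← MonoidHom.coe_comp, h]
  exact SemidirectProduct.inl_injective

theorem racg_forest_embeds_in_doubleStar {VF : Type*} [Fintype VF]
    (F : SimpleGraph VF) (hF : F.IsAcyclic) :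
    ∃ φ : RACG F →* RACG doubleStar, Function.Injective φ := by
  have := infinite_racg_bot
  have : Nonempty (FactorCoset InfDihedral) := ⟨factorCoset false 1⟩
  obtain ⟨e⟩ := hF.nonempty_embedding (G := bassSerreTree InfDihedral)
    bassSerreTree_neighborSet_infinite bassSerreTree_inter_neighborSet_subsingleton
  exact ⟨treeHom.comp (racgMap e.toHom), treeHom_injective.comp (racgMap_injective e)⟩
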